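/- Suppose there exists a close almost-bijection between S(R₁) and S(R₂) for finite multisets R₁, R₂ of positive real numbers. Then R₁ = R₂ as multisets. -/

import Mathlib

open Filter Topology

noncomputable section

/-- Value map for the multiset consisting of `k` zeros together with two copies of
`α i * ℕ⁺` for each `i`. -/
def sval {k : ℕ} (α : Fin k → ℝ) : (Fin k ⊕ (Fin k × ℕ+ × Fin 2)) → ℝ
  | .inl _ => 0
  | .inr (i, n, _) => (n : ℝ) * α i

/-- `S` is the monotone increasing rearrangement of the multiset of `k` zeros together
with two copies of each `α i * ℕ⁺`. -/
def IsSEnum {k : ℕ} (α : Fin k → ℝ) (S : ℕ → ℝ) : Prop :=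
  Monotone S ∧ ∃ e : ℕ ≃ (Fin k ⊕ (Fin k × ℕ+ × Fin 2)), ∀ j, S j = sval α (e j)

/-- `F` (mapping the `j`-th element of the multiset enumerated by `S` to the `F j`-th
element of the multiset enumerated by `A`) is close: for each `ε > 0` only finitely
many elements move by at least `ε`. -/
def CloseSeq (S A : ℕ → ℝ) (F : ℕ → ℕ) : Prop :=
  ∀ ε > 0, {j : ℕ | ε ≤ |A (F j) - S j|}.Finite

/-- `F` is an almost-bijection: all but finitely many targets have exactly one preimage. -/
def AlmostBij (F : ℕ → ℕ) : Prop := {n : ℕ | ¬ ∃! j : ℕ, F j = n}.Finite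

/-- Simultaneous recurrence: arbitrarily large `T` lie close to multiples of each `γ i`. -/
theorem exists_ge_forall_abs_sub_int_mul_lt {ι : Type*} [Fintype ι] (γ : ι → ℝ)
    (hγ : ∀ i, 0 < γ i) {η : ℝ} (hη : 0 < η) (C : ℝ) :
    ∃ T ≥ C, ∀ i, ∃ N : ℤ, |T - N * γ i| < η := by
  have : ∀ i, Fact (0 < γ i) := fun i => ⟨hγ i⟩
  let u : ℕ → ∀ i, AddCircle (γ i) := fun n i => ((n : ℝ) : AddCircle (γ i))
  obtain ⟨a, φ, hφ, hlim⟩ := CompactSpace.tendsto_subseq u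
  obtain ⟨M, hM⟩ := Metric.cauchySeq_iff.mp hlim.cauchySeq η hη
  obtain ⟨b, hb⟩ := exists_nat_ge ((φ M : ℝ) + C)
  have hbφ : (b : ℝ) ≤ φ (max b M) := by
    exact_mod_cast (le_max_left b M).trans (hφ.id_le _)
  refine ⟨(φ (max b M) : ℝ) - φ M, by linarith, fun i => ?_⟩
  have hd := (dist_le_pi_dist _ _ i).trans_lt (hM (max b M) (le_max_right _ _) M le_rfl)
  have hn : ‖(((φ (max b M) : ℝ) - φ M : ℝ) : AddCircle (γ i))‖ < η := by
    rw [dist_eq_norm] at hd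
    simpa [u] using hd
  rw [AddCircle.norm_eq] at hn
  exact ⟨_, hn⟩

/-- The multiples of finitely many positive reals do not accumulate at any point. -/
theorem exists_pos_forall_int_mul_eq_of_abs_sub_lt {ι : Type*} [Finite ι] (β : ι → ℝ)
    (hβ : ∀ i, 0 < β i) (x : ℝ) :
    ∃ δ > 0, ∀ i, ∀ n : ℤ, |n * β i - x| < δ → n * β i = x := by
  have key : ∀ i, ∀ᶠ δ in 𝓝[>] (0 : ℝ), ∀ n : ℤ, |n * β i - x| < δ → n * β i = x := by
    intro i
    by_cases hx : ∃ m : ℤ, m * β i = x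
    · obtain ⟨m, rfl⟩ := hx
      filter_upwards [Ioo_mem_nhdsGT (hβ i)] with δ hδ n hn
      have h1 : |((n - m : ℤ) : ℝ)| * β i < 1 * β i := by
        rw [← abs_of_pos (hβ i), ← abs_mul, abs_of_pos (hβ i)]
        push_cast
        rw [sub_mul, one_mul]
        exact hn.trans hδ.2
      have h2 : |n - m| < 1 := by
        exact_mod_cast lt_of_mul_lt_mul_right h1 (hβ i).le
      rw [sub_eq_zero.mp (Int.abs_lt_one_iff.mp h2)]
    · have hne : 0 < |x / β i - round (x / β i)| * β i := by
        refine mul_pos (abs_pos.mpr fun h => hx ⟨round (x / β i), ?_⟩) (hβ i)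
        rw [← sub_eq_zero.mp h, div_mul_cancel₀ _ (hβ i).ne']
      filter_upwards [Ioo_mem_nhdsGT hne] with δ hδ n hn
      exfalso
      have h1 := mul_le_mul_of_nonneg_right (round_le (x / β i) n) (hβ i).le
      have h2 : |x / β i - n| * β i = |n * β i - x| := by
        rw [← abs_of_pos (hβ i), ← abs_mul, abs_of_pos (hβ i), sub_mul,
          div_mul_cancel₀ _ (hβ i).ne', abs_sub_comm]
      linarith [hδ.2]
  obtain ⟨δ, hδ, hpos⟩ := ((eventually_all.mpr key).and self_mem_nhdsWithin).exists
  exact ⟨δ, hpos, hδ⟩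

/-- A close map that is injective off a finite set cannot decrease the number of progressions
through a given point. -/
theorem card_progressions_le {k₁ k₂ : ℕ} {α : Fin k₁ → ℝ} {β : Fin k₂ → ℝ}
    (hα : ∀ i, 0 < α i) (hβ : ∀ i, 0 < β i) {S₁ S₂ : ℕ → ℝ}
    (h₁ : IsSEnum α S₁) (h₂ : IsSEnum β S₂) {G : ℕ → ℕ} (hclose : CloseSeq S₁ S₂ G)
    {E : Set ℕ} (hE : E.Finite) (hinj : Set.InjOn G Eᶜ) (x : ℝ) :
    Nat.card {i // ∃ n : ℤ, n * α i = x} ≤ Nat.card {i // ∃ n : ℤ, n * β i = x} := by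
  obtain ⟨-, e₁, hS₁⟩ := h₁
  obtain ⟨-, e₂, hS₂⟩ := h₂
  obtain ⟨δ, hδ, hgap⟩ := exists_pos_forall_int_mul_eq_of_abs_sub_lt β hβ x
  have hδ4 : 0 < δ / 4 := by positivity
  obtain ⟨C, hC⟩ := ((hE.union (hclose _ hδ4)).image S₁).bddAbove
  obtain ⟨T, hT, hN⟩ := exists_ge_forall_abs_sub_int_mul_lt (Sum.elim α β)
    (by rintro (i | i); exacts [hα i, hβ i]) hδ4 (max C 0 - x + δ)
  choose N hN using hN
  have hCT : C + δ ≤ T + x := by linarith [le_max_left C 0]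
  have h0T : δ ≤ T + x := by linarith [le_max_right C 0]
  have key : ∀ q : {i // ∃ n : ℤ, n * α i = x} × Fin 2, ∃ j, j ∉ E ∧
      (∃ p, e₁ j = .inr (q.1.1, p, q.2)) ∧
      ∃ r : {i // ∃ n : ℤ, n * β i = x} × Fin 2, ∃ m : ℕ+, e₂ (G j) = .inr (r.1.1, m, r.2) ∧
        ((m - N (.inr r.1.1) : ℤ) : ℝ) * β r.1.1 = x := by
    rintro ⟨⟨i, n, hn⟩, b⟩
    have hNi := abs_lt.mp (hN (.inl i))
    simp only [Sum.elim_inl] at hNi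
    have hpos : 0 < N (.inl i) + n := by
      have : (0 : ℝ) < ((N (.inl i) + n : ℤ) : ℝ) * α i := by
        push_cast
        linarith
      exact_mod_cast (pos_iff_pos_of_mul_pos this).mpr (hα i)
    obtain ⟨p, hp⟩ : ∃ p : ℕ+, ((p : ℕ) : ℤ) = N (.inl i) + n :=
      ⟨⟨(N (.inl i) + n).toNat, by omega⟩, by simp; omega⟩
    have hpR : ((p : ℕ) : ℝ) = N (.inl i) + n := by exact_mod_cast hp
    set j := e₁.symm (.inr (i, p, b)) with hj
    have hSj : S₁ j = N (.inl i) * α i + x := by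
      rw [hS₁, hj, Equiv.apply_symm_apply, sval, hpR, add_mul, hn]
    have hbad : j ∉ E ∪ {j | δ / 4 ≤ |S₂ (G j) - S₁ j|} := by
      intro h
      have := hC ⟨j, h, rfl⟩
      linarith
    simp only [Set.mem_union, Set.mem_ofPred_eq, not_or, not_le] at hbad
    refine ⟨j, hbad.1, ⟨p, by rw [hj, Equiv.apply_symm_apply]⟩, ?_⟩
    have hG := abs_lt.mp hbad.2
    rcases hGj : e₂ (G j) with z | ⟨i', m, b'⟩
    · rw [hS₂ (G j), hGj, sval] at hG
      linarith
    · rw [hS₂ (G j), hGj, sval] at hG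
      have hNi' := abs_lt.mp (hN (.inr i'))
      simp only [Sum.elim_inr] at hNi'
      have hm := hgap i' (m - N (.inr i')) (by
        push_cast
        rw [abs_lt]
        constructor <;> linarith)
      exact ⟨⟨⟨i', _, hm⟩, b'⟩, m, rfl, hm⟩
  choose f hfE hp g m hg hgm using key
  choose p hp using hp
  have hginj : Function.Injective g := by
    intro q q' hqq
    have hm : m q = m q' := by
      have h1 := (hgm q).trans (hgm q').symm
      rw [hqq] at h1
      have h2 := mul_right_cancel₀ (hβ _).ne' h1
      have h3 : ((m q : ℕ) : ℤ) = (m q' : ℕ) := sub_left_inj.mp (Int.cast_injective h2)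
      exact_mod_cast h3
    have hf : f q = f q' := hinj (hfE q) (hfE q') (e₂.injective (by rw [hg, hg, hqq, hm]))
    have h := (hp q).symm.trans ((congrArg e₁ hf).trans (hp q'))
    simp only [Sum.inr.injEq, Prod.mk.injEq] at h
    exact Prod.ext (Subtype.ext h.1) h.2.2
  have := Nat.card_le_card_of_injective g hginj
  rw [Nat.card_prod, Nat.card_prod, Nat.card_fin] at this
  omega

/-- A finite multiset of positive reals is determined by how many of the progressions generated
by its members pass through each point. -/
theorem Multiset.eq_of_countP_int_mul_eq [∀ x : ℝ, DecidablePred fun a : ℝ => ∃ n : ℤ, n * a = x]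
    (R R' : Multiset ℝ) (hR : ∀ a ∈ R, 0 < a) (hR' : ∀ a ∈ R', 0 < a)
    (h : ∀ x : ℝ, R.countP (fun a => ∃ n : ℤ, n * a = x) =
      R'.countP (fun a => ∃ n : ℤ, n * a = x)) : R = R' := by
  have le_of_mul : ∀ {a b : ℝ} {n : ℤ}, 0 < a → 0 < b → n * b = a → b ≤ a := by
    intro a b n ha hb hn
    have hn0 : (0 : ℝ) < n := (pos_iff_pos_of_mul_pos (hn ▸ ha)).mpr hb
    have hn1 : (1 : ℝ) ≤ n := by exact_mod_cast hn0
    nlinarith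
  have exists_le : ∀ {P Q : Multiset ℝ}, (∀ a ∈ P, 0 < a) → (∀ a ∈ Q, 0 < a) →
      (∀ x : ℝ, P.countP (fun a => ∃ n : ℤ, n * a = x) =
        Q.countP (fun a => ∃ n : ℤ, n * a = x)) → ∀ a ∈ P, ∃ b ∈ Q, b ≤ a := by
    intro P Q hP hQ hPQ a ha
    have hpos : 0 < P.countP (fun b => ∃ n : ℤ, n * b = a) :=
      Multiset.countP_pos.mpr ⟨a, ha, 1, by simp⟩
    rw [hPQ, Multiset.countP_pos] at hpos
    obtain ⟨b, hb, n, hn⟩ := hpos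
    exact ⟨b, hb, le_of_mul (hP a ha) (hQ b hb) hn⟩
  induction hc : R.card generalizing R R' with
  | zero =>
    rw [Multiset.card_eq_zero] at hc
    subst hc
    refine (Multiset.eq_zero_of_forall_notMem fun a ha => ?_).symm
    obtain ⟨b, hb, -⟩ := exists_le hR' hR (fun x => (h x).symm) a ha
    simp at hb
  | succ c ih =>
    obtain ⟨a₀, ha₀⟩ := Multiset.card_pos_iff_exists_mem.mp (hc ▸ c.succ_pos : 0 < R.card)
    obtain ⟨a, ha, hmin⟩ := R.toFinset.exists_min_image id ⟨a₀, by simpa using ha₀⟩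
    obtain ⟨b₀, hb₀, -⟩ := exists_le hR hR' h a₀ ha₀
    obtain ⟨b, hb, hmin'⟩ := R'.toFinset.exists_min_image id ⟨b₀, by simpa using hb₀⟩
    simp only [Multiset.mem_toFinset, id] at ha hmin hb hmin'
    have hab : a = b := by
      obtain ⟨b', hb', hba⟩ := exists_le hR hR' h a ha
      obtain ⟨a', ha', hab⟩ := exists_le hR' hR (fun x => (h x).symm) b hb
      linarith [hmin _ ha', hmin' _ hb']
    subst hab
    obtain ⟨t, rfl⟩ := Multiset.exists_cons_of_mem ha
    obtain ⟨t', rfl⟩ := Multiset.exists_cons_of_mem hb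
    rw [ih t t' (fun y hy => hR y (Multiset.mem_cons_of_mem hy))
      (fun y hy => hR' y (Multiset.mem_cons_of_mem hy))
      (fun x => by simpa [Multiset.countP_cons] using h x) (by simpa using hc)]

theorem IsSEnum.finite_setOf_le {k : ℕ} {α : Fin k → ℝ} (hα : ∀ i, 0 < α i) {S : ℕ → ℝ}
    (h : IsSEnum α S) (C : ℝ) : {j | S j ≤ C}.Finite := by
  obtain ⟨hmono, e, he⟩ := h
  by_contra hinf
  have hall : ∀ j, S j ≤ C := by
    intro j
    obtain ⟨l, hl, hjl⟩ := Set.Infinite.exists_gt hinf j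
    exact (hmono hjl.le).trans hl
  have hk : Nonempty (Fin k) := by
    rcases e 0 with i | ⟨i, -⟩ <;> exact ⟨i⟩
  obtain ⟨i⟩ := hk
  obtain ⟨n, hn⟩ := exists_nat_gt (C / α i)
  have h1 := hall (e.symm (.inr (i, n.succPNat, 0)))
  rw [he, Equiv.apply_symm_apply, sval] at h1
  rw [div_lt_iff₀ (hα i)] at hn
  have := hα i
  push_cast [Nat.succPNat_coe] at h1
  linarith

theorem stmt7 {k₁ k₂ : ℕ} (α : Fin k₁ → ℝ) (β : Fin k₂ → ℝ)
    (hα : ∀ i, 0 < α i) (hβ : ∀ i, 0 < β i)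
    (S₁ S₂ : ℕ → ℝ) (h₁ : IsSEnum α S₁) (h₂ : IsSEnum β S₂)
    (F : ℕ → ℕ) (hclose : CloseSeq S₁ S₂ F) (hab : AlmostBij F) :
    (List.ofFn α : Multiset ℝ) = (List.ofFn β : Multiset ℝ) := by
  classical
  have hle : ∀ x : ℝ, Nat.card {i // ∃ n : ℤ, n * α i = x} ≤
      Nat.card {i // ∃ n : ℤ, n * β i = x} := by
    obtain ⟨C, hC⟩ := (hab.image S₂).bddAbove
    refine card_progressions_le hα hβ h₁ h₂ hclose (E := {j | ¬ ∃! l, F l = F j}) ?_ ?_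
    · refine ((hclose 1 one_pos).union (h₁.finite_setOf_le hα (C + 1))).subset fun j hj => ?_
      by_contra hcon
      simp only [Set.mem_union, Set.mem_ofPred_eq, not_or, not_le] at hcon
      have := hC ⟨F j, hj, rfl⟩
      linarith [(abs_lt.mp hcon.1).1]
    · intro j hj l _ hjl
      exact (not_not.mp hj).unique rfl hjl.symm
  have hge : ∀ x : ℝ, Nat.card {i // ∃ n : ℤ, n * β i = x} ≤
      Nat.card {i // ∃ n : ℤ, n * α i = x} := by
    have hG : ∀ n, ∃ j, (∃! l, F l = n) → F j = n := fun n => by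
      by_cases h : ∃! l, F l = n
      · exact ⟨h.choose, fun _ => h.choose_spec.1⟩
      · exact ⟨0, fun h' => absurd h' h⟩
    choose G hG using hG
    refine card_progressions_le hβ hα h₂ h₁ (G := G) (fun ε hε => ?_) hab ?_
    · refine (hab.union ((hclose ε hε).image F)).subset fun n hn => ?_
      by_cases h : ∃! l, F l = n
      · refine Or.inr ⟨G n, ?_, hG n h⟩
        rw [Set.mem_ofPred_eq, hG n h, abs_sub_comm]
        exact hn
      · exact Or.inl h
    · intro n hn l hl hnl
      rw [← hG n (not_not.mp hn), ← hG l (not_not.mp hl), hnl]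
  refine Multiset.eq_of_countP_int_mul_eq _ _ (by simpa [List.mem_ofFn] using hα)
    (by simpa [List.mem_ofFn] using hβ) fun x => ?_
  have h := (hle x).antisymm (hge x)
  rw [Nat.card_eq_fintype_card, Nat.card_eq_fintype_card, Fintype.card_subtype,
    Fintype.card_subtype] at h
  rw [← Fin.univ_val_map, ← Fin.univ_val_map, Multiset.countP_map, Multiset.countP_map]
  exact h
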